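/- Let Ω be a bounded Lipschitz domain in ℝⁿ and Φ: cl(Ω) → ℝⁿ be continuous on cl(Ω), C¹ on Ω, with det(∇Φ) > 0 pointwise in Ω. If there exists an injective continuous map Φ₀: cl(Ω) → ℝⁿ with Φ = Φ₀ on ∂Ω, then Φ is an injective homeomorphism of cl(Ω) onto Φ₀(cl(Ω)) and an injective diffeomorphism of Ω onto Φ₀(Ω). -/

import Mathlib

open MeasureTheory Set Filter Topology


lemma det_weights (n : ℕ) (hn : n ≠ 0) : ∃ w : ℕ → ℝ, ∑ k ∈ Finset.range (n+1), w k = 0 ∧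
    ∀ A : Matrix (Fin n) (Fin n) ℝ,
      ∑ k ∈ Finset.range (n+1), w k * (1 + (k:ℝ) • A).det = (n.factorial : ℝ) * A.det := by
  refine ⟨fun k => (((-1 : ℤ) ^ (n - k) * n.choose k : ℤ) : ℝ), ?_, ?_⟩
  · have h := fwdDiff_iter_eq_sum_shift (1:ℝ) (fun _ : ℝ => (1:ℝ)) n 0
    have h2 : (fwdDiff (1:ℝ))^[n] (fun _ : ℝ => (1:ℝ)) 0 = 0 := by
      have := Polynomial.fwdDiff_iter_eq_zero_of_degree_lt (R := ℝ) (P := 1) (n := n)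
        (by simpa using Nat.pos_of_ne_zero hn)
      have := congrFun this 0
      simpa using this
    rw [h2] at h
    simpa [zsmul_eq_mul] using h.symm
  · intro A
    obtain ⟨P, hP⟩ : ∃ P : Polynomial ℝ, P = ((Polynomial.X : Polynomial ℝ) • A.map Polynomial.C
      + (1 : Matrix (Fin n) (Fin n) ℝ).map Polynomial.C).det := ⟨_, rfl⟩
    have heval : ∀ t : ℝ, P.eval t = (1 + t • A).det := by
      intro t
      rw [hP, ← Polynomial.coe_evalRingHom, RingHom.map_det]
      congr 1
      ext i j
      by_cases hij : i = j
      · subst hij; simp; ring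
      · simp [hij]; ring
    have hdeg : P.natDegree ≤ n := by
      rw [hP]; simpa using Polynomial.natDegree_det_X_add_C_le A 1
    have hc : P.coeff n = A.det := by
      rw [hP]; simpa using Polynomial.coeff_det_X_add_C_card A 1
    have hdiff : (fwdDiff (1:ℝ))^[n] P.eval 0 = (n.factorial : ℝ) * A.det := by
      rcases hdeg.lt_or_eq with h | h
      · rw [Polynomial.fwdDiff_iter_eq_zero_of_degree_lt h, ← hc,
          Polynomial.coeff_eq_zero_of_natDegree_lt h]; simp
      · have := congrFun (Polynomial.fwdDiff_iter_degree_eq_factorial P) 0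
        rw [h, Polynomial.leadingCoeff, h, hc] at this
        rw [this]; simp [mul_comm]
    rw [← hdiff, fwdDiff_iter_eq_sum_shift]
    simp [zsmul_eq_mul, heval]

lemma clm_det_eq {n : ℕ} (A : (Fin n → ℝ) →L[ℝ] (Fin n → ℝ)) :
    A.det = (LinearMap.toMatrix' A.toLinearMap).det := by
  rw [LinearMap.det_toMatrix']

lemma det_weights_clm (n : ℕ) (hn : n ≠ 0) :
    ∃ w : ℕ → ℝ, ∑ k ∈ Finset.range (n+1), w k = 0 ∧
    ∀ A : (Fin n → ℝ) →L[ℝ] (Fin n → ℝ),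
      ∑ k ∈ Finset.range (n+1), w k * (1 + (k:ℝ) • A).det = (n.factorial : ℝ) * A.det := by
  obtain ⟨w, h1, h2⟩ := det_weights n hn
  refine ⟨w, h1, fun A => ?_⟩
  rw [clm_det_eq A, ← h2]
  refine Finset.sum_congr rfl fun k _ => ?_
  rw [clm_det_eq]
  congr 2
  simp only [ContinuousLinearMap.toLinearMap_add, ContinuousLinearMap.toLinearMap_smul, map_add, map_smul]
  congr 1
  exact LinearMap.toMatrix'_one

lemma continuous_clm_det {n : ℕ} :
    Continuous (fun A : (Fin n → ℝ) →L[ℝ] (Fin n → ℝ) => A.det) :=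
  ContinuousLinearMap.continuous_det

lemma integral_det_small {n : ℕ} (u : (Fin n → ℝ) → (Fin n → ℝ))
    (hu : ContDiff ℝ 1 u) (B : Set (Fin n → ℝ)) (hB : IsCompact B) (hs : ∀ x ∉ B, u x = 0) 
    (C : NNReal) (hC : C < 1) (hl : LipschitzWith C u)
    (hpos : ∀ x, 0 < (1 + fderiv ℝ u x).det) :
    ∫ x in B, (1 + fderiv ℝ u x).det = volume.real B := by
  have happ : ApproximatesLinearOn (fun x => x + u x)
      ((ContinuousLinearEquiv.refl ℝ (Fin n → ℝ) : (Fin n → ℝ) ≃L[ℝ] (Fin n → ℝ)) :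
        (Fin n → ℝ) →L[ℝ] (Fin n → ℝ)) univ C := by
    rw [ApproximatesLinearOn.approximatesLinearOn_iff_lipschitzOnWith, lipschitzOnWith_univ]
    have he : (fun x => x + u x) - ⇑((ContinuousLinearEquiv.refl ℝ (Fin n → ℝ) :
        (Fin n → ℝ) ≃L[ℝ] (Fin n → ℝ)) : (Fin n → ℝ) →L[ℝ] (Fin n → ℝ)) = u := by
      ext x; simp
    rw [he]; exact hl
  have hN : Subsingleton (Fin n → ℝ) ∨
      C < ‖((ContinuousLinearEquiv.refl ℝ (Fin n → ℝ)).symm :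
        (Fin n → ℝ) →L[ℝ] (Fin n → ℝ))‖₊⁻¹ := by
    rcases subsingleton_or_nontrivial (Fin n → ℝ) with h | h
    · exact Or.inl h
    · right
      have : ‖((ContinuousLinearEquiv.refl ℝ (Fin n → ℝ)).symm :
        (Fin n → ℝ) →L[ℝ] (Fin n → ℝ))‖₊ = 1 := by
        ext; exact ContinuousLinearMap.norm_id
      rw [this]; simpa using hC
  have hinj := happ.injective hN
  have hinj : Function.Injective (fun x => x + u x) := by
    intro a b hab
    have := @hinj ⟨a, trivial⟩ ⟨b, trivial⟩ hab
    exact congrArg Subtype.val this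
  have hsurj := happ.surjective hN
  have himg : (fun x => x + u x) '' B = B := by
    apply Subset.antisymm
    · rintro _ ⟨x, hx, rfl⟩
      by_contra hc
      have : (x + u x) = x := hinj (by simp [hs _ hc])
      exact hc (by simpa only [this] using hx)
    · intro y hy
      obtain ⟨x, hx⟩ := hsurj y
      refine ⟨x, ?_, hx⟩
      by_contra hc
      simp only [hs x hc, add_zero] at hx
      exact hc (hx ▸ hy)
  have hd : ∀ x ∈ B, HasFDerivWithinAt (fun x => x + u x) (1 + fderiv ℝ u x) B x := by
    intro x _
    exact ((hasFDerivAt_id x).add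
      ((hu.differentiable one_ne_zero) x).hasFDerivAt).hasFDerivWithinAt
  have := integral_image_eq_integral_abs_det_fderiv_smul volume hB.measurableSet hd
    hinj.injOn (fun _ => (1:ℝ))
  rw [himg] at this
  simp only [setIntegral_const, smul_eq_mul, mul_one] at this
  rw [this]
  refine setIntegral_congr_fun hB.measurableSet fun x _ => ?_
  simp [abs_of_pos (hpos x)]

lemma integral_det_zero {n : ℕ} (hn : n ≠ 0) (u : (Fin n → ℝ) → (Fin n → ℝ))
    (hu : ContDiff ℝ 1 u) (hc : HasCompactSupport u) : ∫ x, (fderiv ℝ u x).det = 0 := by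
  obtain ⟨L, hL⟩ := ContDiff.lipschitzWith_of_hasCompactSupport hc hu one_ne_zero
  obtain ⟨w, hw0, hw⟩ := det_weights_clm n hn
  have hdc : ContinuousAt (fun A : (Fin n → ℝ) →L[ℝ] (Fin n → ℝ) => (1 + A).det) 0 :=
    (continuous_clm_det.comp (continuous_const.add continuous_id)).continuousAt
  have hpos : ∀ᶠ A : (Fin n → ℝ) →L[ℝ] (Fin n → ℝ) in 𝓝 0, 0 < (1 + A).det := by
    apply hdc.eventually (lt_mem_nhds _)
    simp [ContinuousLinearMap.det]
  obtain ⟨δ, hδ, hδ'⟩ := Metric.eventually_nhds_iff.1 hpos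
  -- scale
  obtain ⟨c, hc0, hc1⟩ : ∃ c : NNReal, 0 < c ∧ ∀ k ∈ Finset.range (n+1),
      (k * c) * L < 1 ∧ ((k * c) * L : ℝ) < δ := by
    have hp : (0:ℝ) < min 1 δ := lt_min one_pos hδ
    have hq : (0:ℝ) < (n+1) * (L+1) := by positivity
    obtain ⟨c, hcc⟩ : ∃ c : NNReal, (c:ℝ) = min 1 δ / ((n+1) * (L+1)) :=
      ⟨Real.toNNReal _, Real.coe_toNNReal _ (by positivity)⟩
    refine ⟨c, ?_, ?_⟩
    · rw [← NNReal.coe_pos, hcc]; positivity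
    · intro k hk
      have hk' : (k:ℝ) < n + 1 := by exact_mod_cast Finset.mem_range.1 hk
      have key : (k * (min 1 δ / ((n+1) * (L+1))) * L : ℝ) < min 1 δ := by
        rw [mul_div_assoc', div_mul_eq_mul_div, div_lt_iff₀ hq]
        have h1 : (k * L : ℝ) < (n+1) * (L+1) := by
          have : (0:ℝ) ≤ L := L.2
          have : (0:ℝ) ≤ k := by positivity
          nlinarith
        nlinarith
      constructor
      · rw [← NNReal.coe_lt_coe]
        push_cast
        rw [hcc]
        exact key.trans_le (min_le_left _ _)
      · rw [hcc]; exact key.trans_le (min_le_right _ _)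
  have hcd : ∀ k : ℕ, ContDiff ℝ 1 (fun x => ((k * c : NNReal) : ℝ) • u x) := fun k =>
    hu.const_smul _
  have hfd : ∀ k : ℕ, ∀ x, fderiv ℝ (fun x => ((k * c : NNReal) : ℝ) • u x) x
      = ((k * c : NNReal) : ℝ) • fderiv ℝ u x := fun k x =>
    fderiv_fun_const_smul ((hu.differentiable one_ne_zero) x) _
  set B := tsupport u with hBdef
  have hB : IsCompact B := hc
  have hI : ∀ k ∈ Finset.range (n+1),
      ∫ x in B, (1 + (k:ℝ) • ((c:ℝ) • fderiv ℝ u x)).det = volume.real B := by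
    intro k hk
    have hlip : LipschitzWith ((k * c) * L) (fun x => ((k * c : NNReal) : ℝ) • u x) := by
      have := (lipschitzWith_smul (β := Fin n → ℝ) ((k * c : NNReal) : ℝ)).comp hL
      have hnn : ‖((k * c : NNReal) : ℝ)‖₊ = k * c := by simp
      rw [hnn] at this
      exact this
    rw [← integral_det_small (fun x => ((k * c : NNReal) : ℝ) • u x) (hcd k) B hB ?_
      ((k * c) * L) (hc1 k hk).1 hlip ?_]
    · refine setIntegral_congr_fun hB.measurableSet fun x _ => ?_
      simp only [hfd, smul_smul]; push_cast; rfl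
    · intro x hx
      rw [image_eq_zero_of_notMem_tsupport hx, smul_zero]
    · intro x
      apply hδ'
      rw [dist_zero_right]
      refine (norm_fderiv_le_of_lipschitz ℝ hlip).trans_lt ?_
      simpa using (hc1 k hk).2
  have hcont : Continuous (fderiv ℝ u) := hu.continuous_fderiv one_ne_zero
  have hint : ∀ k : ℕ, IntegrableOn
      (fun x => w k * (1 + (k:ℝ) • ((c:ℝ) • fderiv ℝ u x)).det) B := by
    intro k
    refine ContinuousOn.integrableOn_compact hB (Continuous.continuousOn ?_)
    exact continuous_const.mul (continuous_clm_det.comp (by fun_prop))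
  have h1 : ∫ x in B, (n.factorial : ℝ) * ((c:ℝ) • fderiv ℝ u x).det = 0 := by
    simp_rw [← hw]
    rw [integral_finsetSum _ (fun k _ => hint k)]
    simp_rw [integral_const_mul]
    rw [Finset.sum_congr rfl (fun k hk => by rw [hI k hk]), ← Finset.sum_mul, hw0, zero_mul]
  have hdet : ∀ x, ((c:ℝ) • fderiv ℝ u x).det = (c:ℝ)^n * (fderiv ℝ u x).det := by
    intro x
    simp [ContinuousLinearMap.det]
  simp_rw [hdet, integral_const_mul] at h1
  have hc' : (c:ℝ) ≠ 0 := by exact_mod_cast hc0.ne'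
  have h2 : ∫ x in B, (fderiv ℝ u x).det = 0 := by
    have := Nat.factorial_ne_zero n
    have : (n.factorial : ℝ) ≠ 0 := by exact_mod_cast this
    simpa [this, hc'] using h1
  rw [← h2, setIntegral_eq_integral_of_forall_compl_eq_zero]
  intro x hx
  have : fderiv ℝ u x = 0 := by
    by_contra hne
    exact hx (support_fderiv_subset ℝ (by exact hne))
  rw [this]
  have : Nonempty (Fin n) := ⟨⟨0, Nat.pos_of_ne_zero hn⟩⟩
  simp [ContinuousLinearMap.det]

lemma fderiv_coord {n : ℕ} {f : (Fin n → ℝ) → (Fin n → ℝ)} {x : Fin n → ℝ}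
    (hf : DifferentiableAt ℝ f x) (v : Fin n → ℝ) (j : Fin n) :
    fderiv ℝ f x v j = fderiv ℝ (fun y => f y j) x v := by
  have := (hasFDerivAt_pi'.1 hf.hasFDerivAt j).fderiv
  rw [this]; rfl

lemma det_zero_of_coord_const {n : ℕ} {f : (Fin n → ℝ) → (Fin n → ℝ)} {x : Fin n → ℝ}
    (j : Fin n) (c : ℝ) (h : ∀ᶠ y in 𝓝 x, f y j = c) : (fderiv ℝ f x).det = 0 := by
  rw [clm_det_eq]
  apply Matrix.det_eq_zero_of_row_eq_zero j
  intro k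
  rw [LinearMap.toMatrix'_apply]
  by_cases hf : DifferentiableAt ℝ f x
  · have h2 : (fun y => f y j) =ᶠ[𝓝 x] fun _ => c := h
    change fderiv ℝ f x _ j = 0
    rw [fderiv_coord hf, h2.fderiv_eq]; simp
  · rw [fderiv_zero_of_not_differentiableAt hf]; rfl

lemma det_update_sub {n : ℕ} {u u' : (Fin n → ℝ) → (Fin n → ℝ)} {x : Fin n → ℝ} (i : Fin n)
    (hu : DifferentiableAt ℝ u x) (hu' : DifferentiableAt ℝ u' x)
    (h : ∀ y, ∀ j ≠ i, u y j = u' y j) :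
    (fderiv ℝ u x).det - (fderiv ℝ u' x).det =
      (fderiv ℝ (fun y => Function.update (u y) i (u y i - u' y i)) x).det := by
  have hw : DifferentiableAt ℝ (fun y => Function.update (u y) i (u y i - u' y i)) x := by
    rw [differentiableAt_pi] at hu hu' ⊢
    intro j
    by_cases hj : j = i
    · subst hj; simpa using (hu j).fun_sub (hu' j)
    · simpa [hj] using hu j
  rw [clm_det_eq, clm_det_eq, clm_det_eq]
  set M := LinearMap.toMatrix' (fderiv ℝ u x).toLinearMap with hM
  set M' := LinearMap.toMatrix' (fderiv ℝ u' x).toLinearMap with hM'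
  have e1 : M.updateRow i (M' i) = M' := by
    ext j k
    by_cases hj : j = i
    · subst hj; simp
    · rw [Matrix.updateRow_ne hj, hM, hM', LinearMap.toMatrix'_apply, LinearMap.toMatrix'_apply]
      change fderiv ℝ u x _ j = fderiv ℝ u' x _ j
      rw [fderiv_coord hu, fderiv_coord hu']
      simp only [fun y => h y j hj]
  have e2 : LinearMap.toMatrix'
      (fderiv ℝ (fun y => Function.update (u y) i (u y i - u' y i)) x).toLinearMap
      = M.updateRow i (M i - M' i) := by
    ext j k
    rw [LinearMap.toMatrix'_apply]
    change fderiv ℝ (fun y => Function.update (u y) i (u y i - u' y i)) x _ j = _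
    rw [fderiv_coord hw]
    by_cases hj : j = i
    · subst hj
      simp only [Function.update_self, Matrix.updateRow_self, Pi.sub_apply]
      rw [hM, hM', LinearMap.toMatrix'_apply, LinearMap.toMatrix'_apply]
      change _ = fderiv ℝ u x _ j - fderiv ℝ u' x _ j
      rw [fderiv_coord hu, fderiv_coord hu', fderiv_fun_sub
        (differentiableAt_pi.1 hu j) (differentiableAt_pi.1 hu' j)]
      rfl
    · simp only [Matrix.updateRow_ne hj, Function.update_of_ne hj]
      rw [hM, LinearMap.toMatrix'_apply]
      change _ = fderiv ℝ u x _ j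
      rw [fderiv_coord hu]
  rw [e2, sub_eq_add_neg (M i), Matrix.det_updateRow_add, Matrix.updateRow_eq_self,
    ← neg_one_smul ℝ, Matrix.det_updateRow_smul, e1]
  ring

lemma exists_cutoff {n : ℕ} (S Ω : Set (Fin n → ℝ)) (hS : IsCompact S) (hΩ : IsOpen Ω)
    (h : S ⊆ Ω) : ∃ χ : (Fin n → ℝ) → ℝ, ContDiff ℝ 1 χ ∧ HasCompactSupport χ ∧
      tsupport χ ⊆ Ω ∧ ∀ x ∈ S, ∀ᶠ y in 𝓝 x, χ y = 1 := by
  obtain ⟨K, hK, h1, h2⟩ := exists_compact_between hS hΩ h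
  obtain ⟨f, hf1, hf2, -⟩ := exists_contMDiffMap_one_nhds_of_subset_interior
    (n := 1) (modelWithCornersSelf ℝ (Fin n → ℝ)) hS.isClosed h1
  have hsub : tsupport f ⊆ K := by
    refine closure_minimal ?_ hK.isClosed
    intro x hx
    by_contra hc
    exact hx (hf2 x hc)
  refine ⟨f, f.contMDiff.contDiff, hK.of_isClosed_subset (isClosed_tsupport _) hsub, 
    hsub.trans h2, fun x hx => ?_⟩
  exact eventually_nhdsSet_iff_forall.1 hf1 x hx

lemma contDiff_cutoff_mul {n : ℕ} {Ω : Set (Fin n → ℝ)} (hΩ : IsOpen Ω)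
    {χ g : (Fin n → ℝ) → ℝ} (hχ : ContDiff ℝ 1 χ) (hs : tsupport χ ⊆ Ω)
    (hg : ContDiffOn ℝ 1 g Ω) : ContDiff ℝ 1 (fun x => χ x * g x) := by
  rw [contDiff_iff_contDiffAt]
  intro x
  by_cases hx : x ∈ Ω
  · exact hχ.contDiffAt.mul (hg.contDiffAt (hΩ.mem_nhds hx))
  · have : (fun x => χ x * g x) =ᶠ[𝓝 x] fun _ => 0 := by
      have := notMem_tsupport_iff_eventuallyEq.1 (fun h => hx (hs h))
      filter_upwards [this] with y hy
      simp [hy]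
    exact contDiffAt_const.congr_of_eventuallyEq this

lemma integral_det_coord {n : ℕ} {Ω S : Set (Fin n → ℝ)} (hΩ : IsOpen Ω) (hS : IsCompact S)
    (hSΩ : S ⊆ Ω) {w : (Fin n → ℝ) → (Fin n → ℝ)} (hw : ContDiffOn ℝ 1 w Ω) (i : Fin n)
    (h : ∀ x ∈ Ω, x ∉ S → (∃ j ≠ i, ∃ c, ∀ᶠ y in 𝓝 x, w y j = c) ∨ ∀ᶠ y in 𝓝 x, w y i = 0) :
    ∫ x in Ω, (fderiv ℝ w x).det = 0 := by
  have hn : n ≠ 0 := by rintro rfl; exact i.elim0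
  obtain ⟨χ, hχ, hχc, hχs, hχ1⟩ := exists_cutoff S Ω hS hΩ hSΩ
  obtain ⟨χ', hχ', hχc', hχs', hχ1'⟩ := exists_cutoff (tsupport χ) Ω hχc hΩ hχs
  have hST : S ⊆ tsupport χ := by
    intro x hx
    apply subset_tsupport
    have := (hχ1 x hx).self_of_nhds
    simp [this]
  set v : (Fin n → ℝ) → (Fin n → ℝ) :=
    fun x j => (if j = i then χ x else χ' x) * w x j with hv
  have hwj : ∀ j, ContDiffOn ℝ 1 (fun x => w x j) Ω := fun j => contDiffOn_pi.1 hw j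
  have hvc : ContDiff ℝ 1 v := by
    rw [contDiff_pi]
    intro j
    by_cases hj : j = i
    · simp only [hv, hj, if_true]; exact contDiff_cutoff_mul hΩ hχ hχs (hwj i)
    · simp only [hv, hj, if_false]; exact contDiff_cutoff_mul hΩ hχ' hχs' (hwj j)
  have hvs : HasCompactSupport v := by
    refine HasCompactSupport.of_support_subset_isCompact (hχc.isCompact.union hχc'.isCompact) ?_
    intro x hx
    by_contra hc
    simp only [mem_union, not_or] at hc
    apply hx
    ext j
    simp [hv, image_eq_zero_of_notMem_tsupport hc.1, image_eq_zero_of_notMem_tsupport hc.2]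
  have h0 := integral_det_zero hn v hvc hvs
  have hout : ∀ x, x ∉ tsupport χ → (fderiv ℝ v x).det = 0 := by
    intro x hx
    apply det_zero_of_coord_const i 0
    filter_upwards [notMem_tsupport_iff_eventuallyEq.1 hx] with y hy
    simp [hv, hy]
  rw [← h0, ← setIntegral_eq_integral_of_forall_compl_eq_zero (s := Ω)
    (fun x hx => hout x (fun hc => hx (hχs hc)))]
  refine setIntegral_congr_fun hΩ.measurableSet fun x hx => ?_
  by_cases hxS : x ∈ S
  · have : w =ᶠ[𝓝 x] v := by
      filter_upwards [hχ1 x hxS, hχ1' x (hST hxS)] with y hy hy'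
      ext j
      simp [hv, hy, hy']
    rw [this.fderiv_eq]
  · rcases h x hx hxS with ⟨j, hj, c, hc⟩ | h0
    · rw [det_zero_of_coord_const j c hc]
      by_cases hxt : x ∈ tsupport χ
      · rw [det_zero_of_coord_const j c]
        filter_upwards [hc, hχ1' x hxt] with y hy hy'
        simp [hv, hj, hy, hy']
      · rw [hout x hxt]
    · rw [det_zero_of_coord_const i 0 h0, det_zero_of_coord_const i 0]
      filter_upwards [h0] with y hy
      simp [hv, hy]

lemma integrableOn_det {n : ℕ} {Ω S : Set (Fin n → ℝ)} (hΩ : IsOpen Ω) (hS : IsCompact S)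
    (hSΩ : S ⊆ Ω) {u : (Fin n → ℝ) → (Fin n → ℝ)} (hu : ContDiffOn ℝ 1 u Ω)
    (h : ∀ x ∈ Ω, x ∉ S → (fderiv ℝ u x).det = 0) :
    IntegrableOn (fun x => (fderiv ℝ u x).det) Ω := by
  have hc : ContinuousOn (fun x => (fderiv ℝ u x).det) S :=
    continuous_clm_det.comp_continuousOn ((hu.continuousOn_fderiv_of_isOpen hΩ le_rfl).mono hSΩ)
  have h1 : IntegrableOn (fun x => (fderiv ℝ u x).det) S := hc.integrableOn_compact hS
  exact h1.of_forall_sdiff_eq_zero hΩ.measurableSet (fun x hx => h x hx.1 hx.2)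

lemma integral_det_congr_step {n : ℕ} {Ω S : Set (Fin n → ℝ)} (hΩ : IsOpen Ω) (hS : IsCompact S)
    (hSΩ : S ⊆ Ω) {u u' : (Fin n → ℝ) → (Fin n → ℝ)} (hu : ContDiffOn ℝ 1 u Ω)
    (hu' : ContDiffOn ℝ 1 u' Ω) (i : Fin n) (hi : ∀ y, ∀ j ≠ i, u y j = u' y j)
    (h : ∀ x ∈ Ω, x ∉ S → ∃ j c, ∀ᶠ y in 𝓝 x, u y j = c ∧ u' y j = c) :
    ∫ x in Ω, (fderiv ℝ u x).det = ∫ x in Ω, (fderiv ℝ u' x).det := by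
  have i1 := integrableOn_det hΩ hS hSΩ hu (fun x hx hxS => by
    obtain ⟨j, c, hc⟩ := h x hx hxS
    exact det_zero_of_coord_const j c (hc.mono fun y hy => hy.1))
  have i2 := integrableOn_det hΩ hS hSΩ hu' (fun x hx hxS => by
    obtain ⟨j, c, hc⟩ := h x hx hxS
    exact det_zero_of_coord_const j c (hc.mono fun y hy => hy.2))
  rw [← sub_eq_zero, ← integral_sub i1 i2]
  rw [setIntegral_congr_fun hΩ.measurableSet (fun x hx => det_update_sub i
    ((hu.contDiffAt (hΩ.mem_nhds hx)).differentiableAt one_ne_zero)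
    ((hu'.contDiffAt (hΩ.mem_nhds hx)).differentiableAt one_ne_zero) hi)]
  refine integral_det_coord hΩ hS hSΩ ?_ i ?_
  · rw [contDiffOn_pi] at hu hu' ⊢
    intro j
    by_cases hj : j = i
    · subst hj; simpa using (hu j).sub (hu' j)
    · simpa [hj] using hu j
  · intro x hx hxS
    obtain ⟨j, c, hc⟩ := h x hx hxS
    by_cases hj : j = i
    · right
      subst hj
      filter_upwards [hc] with y hy
      simp [hy.1, hy.2]
    · left
      refine ⟨j, hj, c, ?_⟩
      filter_upwards [hc] with y hy
      simp [hj, hy.1]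

lemma integral_det_congr {n : ℕ} {Ω S : Set (Fin n → ℝ)} (hΩ : IsOpen Ω) (hS : IsCompact S)
    (hSΩ : S ⊆ Ω) {u u' : (Fin n → ℝ) → (Fin n → ℝ)} (hu : ContDiffOn ℝ 1 u Ω)
    (hu' : ContDiffOn ℝ 1 u' Ω)
    (h : ∀ x ∈ Ω, x ∉ S → ∃ j c, ∀ᶠ y in 𝓝 x, u y j = c ∧ u' y j = c) :
    ∫ x in Ω, (fderiv ℝ u x).det = ∫ x in Ω, (fderiv ℝ u' x).det := by
  classical
  have key : ∀ s : Finset (Fin n), ∫ x in Ω, (fderiv ℝ u x).det =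
      ∫ x in Ω, (fderiv ℝ (fun x j => if j ∈ s then u' x j else u x j) x).det := by
    have hmix : ∀ s : Finset (Fin n),
        ContDiffOn ℝ 1 (fun x j => if j ∈ s then u' x j else u x j) Ω := by
      intro s
      rw [contDiffOn_pi] at hu hu' ⊢
      intro j
      by_cases hj : j ∈ s
      · simpa [hj] using hu' j
      · simpa [hj] using hu j
    intro s
    induction s using Finset.induction_on with
    | empty => simp
    | insert i s his ih =>
      rw [ih]
      refine integral_det_congr_step hΩ hS hSΩ (hmix s) (hmix _) i ?_ ?_
      · intro y j hj
        simp [hj]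
      · intro x hx hxS
        obtain ⟨j, c, hc⟩ := h x hx hxS
        refine ⟨j, c, ?_⟩
        filter_upwards [hc] with y hy
        simp [hy.1, hy.2]
  simpa using key Finset.univ

/-- coordinatewise smooth step across the box of radius `r` around `z`. -/
noncomputable def stepMap {n : ℕ} (z : Fin n → ℝ) (r : ℝ) (y : Fin n → ℝ) : Fin n → ℝ :=
  fun j => Real.smoothTransition ((y j - z j + r) / (2 * r))

lemma stepMap_contDiff {n : ℕ} (z : Fin n → ℝ) (r : ℝ) : ContDiff ℝ 1 (stepMap z r) := by
  rw [contDiff_pi]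
  intro j
  have h : ContDiff ℝ 1 (fun y : Fin n → ℝ => (y j - z j + r) / (2 * r)) := by fun_prop
  exact (Real.smoothTransition.contDiff (n := 1)).comp h

lemma stepMap_one {n : ℕ} {z : Fin n → ℝ} {r : ℝ} (hr : 0 < r) {y : Fin n → ℝ} {j : Fin n}
    (h : z j + r < y j) : stepMap z r y j = 1 := by
  apply Real.smoothTransition.one_of_one_le
  rw [le_div_iff₀ (by positivity)]; linarith

lemma stepMap_zero {n : ℕ} {z : Fin n → ℝ} {r : ℝ} (hr : 0 < r) {y : Fin n → ℝ} {j : Fin n}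
    (h : y j < z j - r) : stepMap z r y j = 0 := by
  apply Real.smoothTransition.zero_of_nonpos
  apply div_nonpos_of_nonpos_of_nonneg <;> linarith

lemma stepMap_det_zero {n : ℕ} {z : Fin n → ℝ} {r : ℝ} (hr : 0 < r) {y : Fin n → ℝ}
    (h : y ∉ Metric.closedBall z r) : (fderiv ℝ (stepMap z r) y).det = 0 := by
  rw [Metric.mem_closedBall, dist_pi_le_iff hr.le] at h
  push Not at h
  obtain ⟨j, hj⟩ := h
  rw [Real.dist_eq, lt_abs] at hj
  have hcj : Continuous (fun x : Fin n → ℝ => x j) := continuous_apply j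
  rcases hj with hj | hj
  · apply det_zero_of_coord_const j 1
    filter_upwards [hcj.continuousAt.eventually (lt_mem_nhds (show z j + r < y j by linarith))]
      with x hx using stepMap_one hr hx
  · apply det_zero_of_coord_const j 0
    filter_upwards [hcj.continuousAt.eventually (gt_mem_nhds (show y j < z j - r by linarith))]
      with x hx using stepMap_zero hr hx

lemma integral_deriv_step (a r : ℝ) (hr : 0 < r) :
    ∫ t, deriv (fun t : ℝ => Real.smoothTransition ((t - a + r) / (2 * r))) t = 1 := by
  set s : ℝ → ℝ := fun t : ℝ => Real.smoothTransition ((t - a + r) / (2 * r)) with hs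
  have hc : ContDiff ℝ 1 s := by
    have h : ContDiff ℝ 1 (fun y : ℝ => (y - a + r) / (2 * r)) := by fun_prop
    exact (Real.smoothTransition.contDiff (n := 1)).comp h
  have hout : ∀ t, t ∉ Ioc (a - r) (a + r) → deriv s t = 0 := by
    have h1 : ∀ t, a + r < t → deriv s t = 0 := by
      intro t ht
      have : s =ᶠ[𝓝 t] fun _ => 1 := by
        filter_upwards [lt_mem_nhds ht] with x hx
        apply Real.smoothTransition.one_of_one_le
        rw [le_div_iff₀ (by positivity)]; linarith
      rw [this.deriv_eq]; simp
    have h0 : ∀ t, t < a - r → deriv s t = 0 := by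
      intro t ht
      have : s =ᶠ[𝓝 t] fun _ => 0 := by
        filter_upwards [gt_mem_nhds ht] with x hx
        apply Real.smoothTransition.zero_of_nonpos
        apply div_nonpos_of_nonpos_of_nonneg <;> linarith
      rw [this.deriv_eq]; simp
    intro t ht
    rw [mem_Ioc, not_and_or, not_lt, not_le] at ht
    rcases ht with ht | ht
    · have hcl : IsClosed {t | deriv s t = 0} :=
        isClosed_eq (hc.continuous_deriv le_rfl) continuous_const
      have : Iic (a - r) ⊆ {t | deriv s t = 0} := by
        rw [← closure_Iio]
        exact hcl.closure_subset_iff.2 (fun x hx => h0 x hx)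
      exact this ht
    · exact h1 t ht
  rw [← setIntegral_eq_integral_of_forall_compl_eq_zero hout,
    ← intervalIntegral.integral_of_le (by linarith),
    intervalIntegral.integral_deriv_eq_sub
      (fun x _ => (hc.differentiable one_ne_zero) x)
      ((hc.continuous_deriv le_rfl).intervalIntegrable _ _)]
  have e1 : s (a + r) = 1 := by
    apply Real.smoothTransition.one_of_one_le
    rw [le_div_iff₀ (by positivity)]; linarith
  have e0 : s (a - r) = 0 := by
    apply Real.smoothTransition.zero_of_nonpos
    apply div_nonpos_of_nonpos_of_nonneg <;> linarith
  rw [e1, e0, sub_zero]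

lemma stepMap_det {n : ℕ} (z : Fin n → ℝ) (r : ℝ) (y : Fin n → ℝ) :
    (fderiv ℝ (stepMap z r) y).det =
      ∏ j, deriv (fun t : ℝ => Real.smoothTransition ((t - z j + r) / (2 * r))) (y j) := by
  rw [clm_det_eq, ← Matrix.det_diagonal]
  congr 1
  ext j k
  rw [LinearMap.toMatrix'_apply]
  change fderiv ℝ (stepMap z r) y _ j = _
  rw [fderiv_coord ((stepMap_contDiff z r).differentiable one_ne_zero y)]
  have hc : ContDiff ℝ 1 (fun t : ℝ => Real.smoothTransition ((t - z j + r) / (2 * r))) := by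
    have h : ContDiff ℝ 1 (fun y : ℝ => (y - z j + r) / (2 * r)) := by fun_prop
    exact (Real.smoothTransition.contDiff (n := 1)).comp h
  have hd := ((hc.differentiable one_ne_zero) (y j)).hasDerivAt
  have hp : HasFDerivAt (fun x : Fin n → ℝ => x j)
    (ContinuousLinearMap.proj (R := ℝ) (φ := fun _ : Fin n => ℝ) j) y := hasFDerivAt_apply j y
  have := (hd.comp_hasFDerivAt y hp).fderiv
  have e : (fun y : Fin n → ℝ => stepMap z r y j) = 
    (fun t : ℝ => Real.smoothTransition ((t - z j + r) / (2 * r))) ∘ (fun x : Fin n → ℝ => x j) := rfl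
  rw [e, this]
  by_cases hjk : j = k
  · subst hjk; simp
  · simp [hjk]

lemma stepMap_integral {n : ℕ} {z : Fin n → ℝ} {r : ℝ} (hr : 0 < r) {V : Set (Fin n → ℝ)}
    (hV : Metric.closedBall z r ⊆ V) : ∫ y in V, (fderiv ℝ (stepMap z r) y).det = 1 := by
  rw [setIntegral_eq_integral_of_forall_compl_eq_zero
    (fun x hx => stepMap_det_zero hr (fun hc => hx (hV hc)))]
  simp_rw [stepMap_det]
  rw [integral_fintype_prod_volume_eq_prod
    (f := fun j => deriv (fun t : ℝ => Real.smoothTransition ((t - z j + r) / (2 * r))))]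
  simp_rw [fun j => integral_deriv_step (z j) r hr]
  simp

lemma local_structure {n : ℕ} {Ω : Set (Fin n → ℝ)} (hΩ : IsOpen Ω) (hb : Bornology.IsBounded Ω)
    {f : (Fin n → ℝ) → (Fin n → ℝ)} (hfc : ContinuousOn f (closure Ω)) (hf : ContDiffOn ℝ 1 f Ω)
    (z : Fin n → ℝ) (hz : ∀ x ∈ frontier Ω, f x ≠ z)
    (hreg : ∀ x ∈ Ω, f x = z → (fderiv ℝ f x).det ≠ 0) :
    ∃ s : Finset (Fin n → ℝ), (∀ x, x ∈ s ↔ x ∈ Ω ∧ f x = z) ∧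
    ∃ U : (Fin n → ℝ) → Set (Fin n → ℝ),
      (∀ x ∈ s, IsOpen (U x) ∧ x ∈ U x ∧ U x ⊆ Ω ∧ InjOn f (U x) ∧
        ∀ y ∈ U x, SignType.sign (fderiv ℝ f y).det = SignType.sign (fderiv ℝ f x).det) ∧
      (s : Set (Fin n → ℝ)).PairwiseDisjoint U ∧
    ∃ V ∈ 𝓝 z, (∀ x ∈ s, V ⊆ f '' U x) ∧ ∀ x ∈ closure Ω, f x ∈ V → ∃ x' ∈ s, x ∈ U x' := by
  have hK : IsCompact (closure Ω) := hb.isCompact_closure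
  have hmem : ∀ x ∈ closure Ω, f x = z → x ∈ Ω := by
    intro x hx hfx
    by_contra hc
    refine hz x ?_ hfx
    rw [hΩ.frontier_eq]; exact ⟨hx, hc⟩
  have hloc : ∀ x, x ∈ Ω → f x = z → ∃ W : Set (Fin n → ℝ), IsOpen W ∧ x ∈ W ∧ W ⊆ Ω ∧
      InjOn f W ∧
      (∀ y ∈ W, SignType.sign (fderiv ℝ f y).det = SignType.sign (fderiv ℝ f x).det) ∧
      (∀ U ∈ 𝓝 x, f '' U ∈ 𝓝 z) := by
    intro x hx hfx
    have hca := hf.contDiffAt (hΩ.mem_nhds hx)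
    have hne := hreg x hx hfx
    set e := (fderiv ℝ f x).toContinuousLinearEquivOfDetNeZero hne with he
    have hs : HasStrictFDerivAt f (e : (Fin n → ℝ) →L[ℝ] (Fin n → ℝ)) x := by
      have := hca.hasStrictFDerivAt one_ne_zero
      simpa [he] using this
    have hdc : ContinuousAt (fun y => (fderiv ℝ f y).det) x :=
      (continuous_clm_det.continuousAt).comp
        ((hf.continuousOn_fderiv_of_isOpen hΩ le_rfl).continuousAt (hΩ.mem_nhds hx))
    have hsign : ∀ᶠ y in 𝓝 x, 
        SignType.sign (fderiv ℝ f y).det = SignType.sign (fderiv ℝ f x).det := by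
      rcases hne.lt_or_gt with h | h
      · filter_upwards [hdc.eventually (gt_mem_nhds h)] with y hy
        rw [sign_neg h, sign_neg hy]
      · filter_upwards [hdc.eventually (lt_mem_nhds h)] with y hy
        rw [sign_pos h, sign_pos hy]
    obtain ⟨T, hT, hTo, hxT⟩ := eventually_nhds_iff.1 hsign
    have hinj := (hs.toOpenPartialHomeomorph f).injOn
    rw [hs.toOpenPartialHomeomorph_coe] at hinj
    refine ⟨(hs.toOpenPartialHomeomorph f).source ∩ (Ω ∩ T),
      (hs.toOpenPartialHomeomorph f).open_source.inter (hΩ.inter hTo),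
      ⟨hs.mem_toOpenPartialHomeomorph_source, hx, hxT⟩, fun y hy => hy.2.1,
      hinj.mono inter_subset_left, fun y hy => hT y hy.2.2, fun U hU => ?_⟩
    rw [← hfx, ← hs.map_nhds_eq_of_equiv]
    exact image_mem_map hU
  choose! W hWo hxW hWΩ hWi hWs hWn using hloc
  set P := closure Ω ∩ f ⁻¹' {z} with hP
  have hPc : IsCompact P := 
    hK.of_isClosed_subset (hfc.preimage_isClosed_of_isClosed isClosed_closure isClosed_singleton)
      inter_subset_left
  have hPm : ∀ x, x ∈ P ↔ x ∈ Ω ∧ f x = z := fun x =>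
    ⟨fun h => ⟨hmem x h.1 h.2, h.2⟩, fun h => ⟨subset_closure h.1, h.2⟩⟩
  have hPfin : P.Finite := by
    obtain ⟨t, ht, htc⟩ := hPc.elim_nhds_subcover W (fun x hx => by
      obtain ⟨h1, h2⟩ := (hPm x).1 hx
      exact (hWo x h1 h2).mem_nhds (hxW x h1 h2))
    refine t.finite_toSet.subset fun x hx => ?_
    obtain ⟨y, hy, hxy⟩ := mem_iUnion₂.1 (htc hx)
    obtain ⟨h1, h2⟩ := (hPm y).1 (ht y hy)
    have : x = y := hWi y h1 h2 hxy (hxW y h1 h2) (((hPm x).1 hx).2.trans h2.symm)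
    rw [this]; exact hy
  obtain ⟨D, hD, hDd⟩ := hPfin.t2_separation
  have hs : ∀ x, x ∈ hPfin.toFinset ↔ x ∈ Ω ∧ f x = z := fun x => by
    rw [hPfin.mem_toFinset, hPm]
  refine ⟨hPfin.toFinset, hs, fun x => D x ∩ W x, ?_, ?_, ?_⟩
  · intro x hx
    obtain ⟨h1, h2⟩ := (hs x).1 hx
    exact ⟨(hD x).2.inter (hWo x h1 h2), ⟨(hD x).1, hxW x h1 h2⟩,
      fun y hy => hWΩ x h1 h2 hy.2, (hWi x h1 h2).mono inter_subset_right,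
      fun y hy => hWs x h1 h2 y hy.2⟩
  · intro x hx y hy hxy
    exact (hDd (by simpa using hx) (by simpa using hy) hxy).mono inter_subset_left inter_subset_left
  · have hUo : ∀ x ∈ hPfin.toFinset, IsOpen (D x ∩ W x) := fun x hx => by
      obtain ⟨h1, h2⟩ := (hs x).1 hx
      exact (hD x).2.inter (hWo x h1 h2)
    set R := closure Ω \ ⋃ x ∈ hPfin.toFinset, (D x ∩ W x) with hR
    have hRc : IsCompact R := hK.diff (isOpen_biUnion hUo)
    have hRi : IsCompact (f '' R) := hRc.image_of_continuousOn (hfc.mono sdiff_subset)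
    have hzR : z ∉ f '' R := by
      rintro ⟨x, hx, hfx⟩
      apply hx.2
      have : x ∈ hPfin.toFinset := (hs x).2 ⟨hmem x hx.1 hfx, hfx⟩
      exact mem_iUnion₂.2 ⟨x, this, (hD x).1, hxW x ((hs x).1 this).1 hfx⟩
    refine ⟨(⋂ x ∈ hPfin.toFinset, f '' (D x ∩ W x)) ∩ (f '' R)ᶜ, ?_, ?_, ?_⟩
    · refine inter_mem ((Filter.biInter_finset_mem _).2 fun x hx => ?_)
        (hRi.isClosed.isOpen_compl.mem_nhds hzR)
      obtain ⟨h1, h2⟩ := (hs x).1 hx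
      exact hWn x h1 h2 _ ((hUo x hx).mem_nhds ⟨(hD x).1, hxW x h1 h2⟩)
    · intro x hx y hy
      exact mem_iInter₂.1 hy.1 x hx
    · intro x hx hfx
      by_contra hc
      apply hfx.2
      refine ⟨x, ⟨hx, fun h => hc ?_⟩, rfl⟩
      obtain ⟨y, hy, hxy⟩ := mem_iUnion₂.1 h
      exact ⟨y, hy, hxy⟩

lemma integral_count {n : ℕ} {Ω : Set (Fin n → ℝ)} (hΩ : IsOpen Ω) (hb : Bornology.IsBounded Ω)
    {f : (Fin n → ℝ) → (Fin n → ℝ)} (hfc : ContinuousOn f (closure Ω)) (hf : ContDiffOn ℝ 1 f Ω)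
    (z : Fin n → ℝ) (hz : ∀ x ∈ frontier Ω, f x ≠ z)
    (hreg : ∀ x ∈ Ω, f x = z → (fderiv ℝ f x).det ≠ 0)
    (s : Finset (Fin n → ℝ)) (hs : ∀ x, x ∈ s ↔ x ∈ Ω ∧ f x = z) :
    ∃ r₀ > 0, ∀ r, 0 < r → r < r₀ →
      ∫ x in Ω, (fderiv ℝ (fun x => stepMap z r (f x)) x).det =
        ((∑ x ∈ s, (SignType.sign (fderiv ℝ f x).det : ℤ) : ℤ) : ℝ) := by
  obtain ⟨s', hs', U, hU, hUd, V, hV, hVU, hVc⟩ := local_structure hΩ hb hfc hf z hz hreg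
  have hss : s' = s := by ext x; rw [hs, hs']
  subst hss
  obtain ⟨r₀, hr₀, hball⟩ := Metric.mem_nhds_iff.1 hV
  refine ⟨r₀, hr₀, fun r hr hrr => ?_⟩
  have hcb : Metric.closedBall z r ⊆ V := (Metric.closedBall_subset_ball hrr).trans hball
  have hK : IsCompact (closure Ω) := hb.isCompact_closure
  have hchain : ∀ x ∈ Ω, (fderiv ℝ (fun x => stepMap z r (f x)) x).det =
      (fderiv ℝ (stepMap z r) (f x)).det * (fderiv ℝ f x).det := by
    intro x hx
    have h1 := ((stepMap_contDiff z r).differentiable one_ne_zero (f x)).hasFDerivAt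
    have h2 := ((hf.contDiffAt (hΩ.mem_nhds hx)).differentiableAt one_ne_zero).hasFDerivAt
    have h3 := (h1.comp x h2).fderiv
    change (fderiv ℝ (stepMap z r ∘ f) x).det = _
    rw [h3]
    exact LinearMap.det_comp _ _
  have hzero : ∀ x ∈ Ω, f x ∉ Metric.closedBall z r → 
      (fderiv ℝ (fun x => stepMap z r (f x)) x).det = 0 := by
    intro x hx h
    rw [hchain x hx, stepMap_det_zero hr h, zero_mul]
  have hint : IntegrableOn (fun x => (fderiv ℝ (fun x => stepMap z r (f x)) x).det) Ω := by
    refine integrableOn_det (S := closure Ω ∩ f ⁻¹' Metric.closedBall z r) hΩ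
      (hK.of_isClosed_subset (hfc.preimage_isClosed_of_isClosed isClosed_closure
        Metric.isClosed_closedBall) inter_subset_left) ?_ ?_ ?_
    · rintro x ⟨hx, hfx⟩
      obtain ⟨x', hx', hxU⟩ := hVc x hx (hcb hfx)
      exact (hU x' hx').2.2.1 hxU
    · exact (stepMap_contDiff z r).comp_contDiffOn hf
    · intro x hx hxS
      exact hzero x hx (fun h => hxS ⟨subset_closure hx, h⟩)
  have hsub : (⋃ x ∈ s', U x) ⊆ Ω := iUnion₂_subset fun x hx => (hU x hx).2.2.1
  rw [setIntegral_eq_of_subset_of_forall_sdiff_eq_zero hΩ.measurableSet hsub (fun x hx => by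
    refine hzero x hx.1 fun h => hx.2 ?_
    obtain ⟨x', hx', hxU⟩ := hVc x (subset_closure hx.1) (hcb h)
    exact mem_iUnion₂.2 ⟨x', hx', hxU⟩)]
  rw [integral_biUnion_finset s' (fun x hx => (hU x hx).1.measurableSet) hUd
    (fun x hx => hint.mono_set (hU x hx).2.2.1)]
  push_cast
  refine Finset.sum_congr rfl fun x hx => ?_
  obtain ⟨hUo, hxU, hUΩ, hUi, hUs⟩ := hU x hx
  have hcov := integral_image_eq_integral_abs_det_fderiv_smul volume hUo.measurableSet
    (f := f) (f' := fderiv ℝ f) (fun y hy => ((hf.contDiffAt (hΩ.mem_nhds (hUΩ hy))).differentiableAt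
      one_ne_zero).hasFDerivAt.hasFDerivWithinAt) hUi
    (fun y => (fderiv ℝ (stepMap z r) y).det)
  rw [stepMap_integral hr (hcb.trans (hVU x hx))] at hcov
  have : ∫ y in U x, (fderiv ℝ (fun x => stepMap z r (f x)) y).det =
      ∫ y in U x, ((SignType.sign (fderiv ℝ f x).det : ℤ) : ℝ) *
        (|(fderiv ℝ f y).det| • (fderiv ℝ (stepMap z r) (f y)).det) := by
    refine setIntegral_congr_fun hUo.measurableSet fun y hy => ?_
    rw [hchain y (hUΩ hy), smul_eq_mul, ← mul_assoc, ← hUs y hy]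
    have : (((SignType.sign (fderiv ℝ f y).det : SignType) : ℤ) : ℝ) * |(fderiv ℝ f y).det| =
      (fderiv ℝ f y).det := by
      have := sign_mul_abs (fderiv ℝ f y).det
      simpa using this
    rw [this, mul_comm]
  rw [this, integral_const_mul, ← hcov, mul_one]
  simp

lemma degree_congr {n : ℕ} {Ω : Set (Fin n → ℝ)} (hΩ : IsOpen Ω) (hb : Bornology.IsBounded Ω)
    {f f' : (Fin n → ℝ) → (Fin n → ℝ)}
    (hfc : ContinuousOn f (closure Ω)) (hf : ContDiffOn ℝ 1 f Ω)
    (hfc' : ContinuousOn f' (closure Ω)) (hf' : ContDiffOn ℝ 1 f' Ω)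
    (z : Fin n → ℝ) (δ : ℝ) (hδ : 0 < δ) (hz : ∀ x ∈ frontier Ω, 2 * δ ≤ dist (f x) z)
    (hz' : ∀ x ∈ frontier Ω, dist (f x) (f' x) < δ)
    (hreg : ∀ x ∈ Ω, f x = z → (fderiv ℝ f x).det ≠ 0)
    (hreg' : ∀ x ∈ Ω, f' x = z → (fderiv ℝ f' x).det ≠ 0)
    (s : Finset (Fin n → ℝ)) (hs : ∀ x, x ∈ s ↔ x ∈ Ω ∧ f x = z)
    (s' : Finset (Fin n → ℝ)) (hs' : ∀ x, x ∈ s' ↔ x ∈ Ω ∧ f' x = z) :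
    ∑ x ∈ s, (SignType.sign (fderiv ℝ f x).det : ℤ) =
      ∑ x ∈ s', (SignType.sign (fderiv ℝ f' x).det : ℤ) := by
  have hK : IsCompact (closure Ω) := hb.isCompact_closure
  obtain ⟨r₁, hr₁, h1⟩ := integral_count hΩ hb hfc hf z (fun x hx h => by
    have := hz x hx
    rw [h, dist_self] at this; linarith) hreg s hs
  obtain ⟨r₂, hr₂, h2⟩ := integral_count hΩ hb hfc' hf' z (fun x hx h => by
    have := hz x hx
    have := hz' x hx
    rw [h] at this; linarith) hreg' s' hs'
  obtain ⟨r, hr, hr'⟩ := exists_between (lt_min (lt_min hr₁ hr₂) hδ)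
  simp only [lt_min_iff] at hr'
  have e1 := h1 r hr hr'.1.1
  have e2 := h2 r hr hr'.1.2
  suffices H : ∫ x in Ω, (fderiv ℝ (fun x => stepMap z r (f x)) x).det =
      ∫ x in Ω, (fderiv ℝ (fun x => stepMap z r (f' x)) x).det by
    rw [e1, e2] at H
    exact_mod_cast H
  set G : Set ((Fin n → ℝ) × (Fin n → ℝ)) := ⋃ j : Fin n,
    ({p | z j + r < p.1 j} ∩ {p | z j + r < p.2 j}) ∪
      ({p | p.1 j < z j - r} ∩ {p | p.2 j < z j - r}) with hG
  have hGo : IsOpen G := by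
    refine isOpen_iUnion fun j => ?_
    refine IsOpen.union (IsOpen.inter ?_ ?_) (IsOpen.inter ?_ ?_)
    · exact isOpen_lt continuous_const (by fun_prop)
    · exact isOpen_lt continuous_const (by fun_prop)
    · exact isOpen_lt (by fun_prop) continuous_const
    · exact isOpen_lt (by fun_prop) continuous_const
  have hfr : ∀ x ∈ frontier Ω, (f x, f' x) ∈ G := by
    intro x hx
    have h1 := hz x hx
    have h2 := hz' x hx
    have h3 : ¬ dist (f x) z < 2 * δ := not_lt.2 h1
    rw [dist_pi_lt_iff (by positivity)] at h3
    push Not at h3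
    obtain ⟨j, hj⟩ := h3
    have h4 := (dist_pi_lt_iff hδ).1 h2 j
    rw [Real.dist_eq] at hj h4
    rw [abs_lt] at h4
    refine mem_iUnion.2 ⟨j, ?_⟩
    rcases le_abs.1 hj with hj | hj
    · left
      constructor
      · change z j + r < f x j; linarith
      · change z j + r < f' x j; linarith
    · right
      constructor
      · change f x j < z j - r; linarith
      · change f' x j < z j - r; linarith
  have hcont : ContinuousOn (fun x => (f x, f' x)) (closure Ω) := hfc.prodMk hfc'
  refine integral_det_congr (S := closure Ω ∩ (fun x => (f x, f' x)) ⁻¹' Gᶜ) hΩ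
    (hK.of_isClosed_subset (hcont.preimage_isClosed_of_isClosed isClosed_closure
        hGo.isClosed_compl) inter_subset_left) ?_
    ((stepMap_contDiff z r).comp_contDiffOn hf) ((stepMap_contDiff z r).comp_contDiffOn hf') ?_
  · rintro x ⟨hx, hxG⟩
    by_contra hc
    refine hxG (hfr x ?_)
    rw [hΩ.frontier_eq]; exact ⟨hx, hc⟩
  · intro x hx hxS
    have hxG : (f x, f' x) ∈ G := by
      by_contra hc
      exact hxS ⟨subset_closure hx, hc⟩
    obtain ⟨j, hj⟩ := mem_iUnion.1 hxG
    have c1 : ContinuousAt (fun y => f y j) x :=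
      (continuous_apply j).continuousAt.comp (hf.contDiffAt (hΩ.mem_nhds hx)).continuousAt
    have c2 : ContinuousAt (fun y => f' y j) x :=
      (continuous_apply j).continuousAt.comp (hf'.contDiffAt (hΩ.mem_nhds hx)).continuousAt
    rcases hj with ⟨ha, hb⟩ | ⟨ha, hb⟩
    · refine ⟨j, 1, ?_⟩
      filter_upwards [c1.eventually (lt_mem_nhds ha), c2.eventually (lt_mem_nhds hb)] with y hy hy'
      exact ⟨stepMap_one hr hy, stepMap_one hr hy'⟩
    · refine ⟨j, 0, ?_⟩
      filter_upwards [c1.eventually (gt_mem_nhds ha), c2.eventually (gt_mem_nhds hb)] with y hy hy'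
      exact ⟨stepMap_zero hr hy, stepMap_zero hr hy'⟩

/-- local constancy of the number of preimages -/
lemma count_locally_const {n : ℕ} {Ω : Set (Fin n → ℝ)} (hΩ : IsOpen Ω)
    (hb : Bornology.IsBounded Ω)
    {f : (Fin n → ℝ) → (Fin n → ℝ)} (hfc : ContinuousOn f (closure Ω)) (hf : ContDiffOn ℝ 1 f Ω)
    (z : Fin n → ℝ) (hz : ∀ x ∈ frontier Ω, f x ≠ z)
    (hreg : ∀ x ∈ Ω, f x = z → (fderiv ℝ f x).det ≠ 0) :
    ∃ k : ℕ, (∃ s : Finset (Fin n → ℝ), (∀ x, x ∈ s ↔ x ∈ Ω ∧ f x = z) ∧ s.card = k) ∧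
      ∀ᶠ y in 𝓝 z, 
      ∃ s : Finset (Fin n → ℝ), (∀ x, x ∈ s ↔ x ∈ Ω ∧ f x = y) ∧ s.card = k := by
  classical
  obtain ⟨s, hs, U, hU, hUd, V, hV, hVU, hVc⟩ := local_structure hΩ hb hfc hf z hz hreg
  refine ⟨s.card, ⟨s, hs, rfl⟩, ?_⟩
  filter_upwards [hV] with y hy
  have hex : ∀ x ∈ s, ∃ x', x' ∈ U x ∧ f x' = y := fun x hx => hVU x hx hy
  choose! g hgU hgy using hex
  refine ⟨s.image g, fun x => ?_, ?_⟩
  · rw [Finset.mem_image]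
    constructor
    · rintro ⟨a, ha, rfl⟩
      exact ⟨(hU a ha).2.2.1 (hgU a ha), hgy a ha⟩
    · rintro ⟨hx, hfx⟩
      obtain ⟨a, ha, hxa⟩ := hVc x (subset_closure hx) (hfx ▸ hy)
      exact ⟨a, ha, (hU a ha).2.2.2.1 (hgU a ha) hxa ((hgy a ha).trans hfx.symm)⟩
  · apply Finset.card_image_of_injOn
    intro a ha b hb' hab
    by_contra hne
    exact Set.disjoint_left.1 (hUd ha hb' hne) (hgU a ha) (hab ▸ hgU b hb')

lemma approx_smooth {n : ℕ} (g : C(Fin n → ℝ, Fin n → ℝ)) {ε : ℝ} (hε : 0 < ε) :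
    ∃ G : (Fin n → ℝ) → (Fin n → ℝ), ContDiff ℝ 1 G ∧ ∀ x, dist (G x) (g x) < ε := by
  obtain ⟨G, h1, h2, -⟩ := g.continuous.exists_contDiff_approx 1 (ε := fun _ => ε)
    continuous_const (fun _ => hε)
  exact ⟨G, h1, h2⟩

lemma exists_regular_value {n : ℕ} {G : (Fin n → ℝ) → (Fin n → ℝ)} (hG : ContDiff ℝ 1 G)
    (z : Fin n → ℝ) {ε : ℝ} (hε : 0 < ε) :
    ∃ z₁, dist z₁ z < ε ∧ ∀ y, G y = z₁ → (fderiv ℝ G y).det ≠ 0 := by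
  have h0 : volume (G '' {y | (fderiv ℝ G y).det = 0}) = 0 :=
    addHaar_image_eq_zero_of_det_fderivWithin_eq_zero volume (f' := fderiv ℝ G)
      (fun x _ => (hG.differentiable one_ne_zero x).hasFDerivAt.hasFDerivWithinAt)
      (fun x hx => hx)
  have h1 : 0 < volume (Metric.ball z ε) := Metric.measure_ball_pos _ _ hε
  have : ¬ Metric.ball z ε ⊆ G '' {y | (fderiv ℝ G y).det = 0} := fun h =>
    h1.ne' (measure_mono_null h h0)
  obtain ⟨z₁, hz₁, hn⟩ := not_subset.1 this
  exact ⟨z₁, hz₁, fun y hy hd => hn ⟨y, hd, hy⟩⟩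

lemma main_step1 {n : ℕ} {Ω : Set (Fin n → ℝ)} (hΩo : IsOpen Ω) (hΩb : Bornology.IsBounded Ω)
    {Φ Φ₀ : (Fin n → ℝ) → (Fin n → ℝ)}
    (hΦc : ContinuousOn Φ (closure Ω)) (hΦd : ContDiffOn ℝ 1 Φ Ω)
    (hdet : ∀ x ∈ Ω, 0 < (fderiv ℝ Φ x).det)
    (hΦ₀c : ContinuousOn Φ₀ (closure Ω))
    (hbd : ∀ x ∈ frontier Ω, Φ x = Φ₀ x) : Φ '' Ω ⊆ Φ₀ '' closure Ω := by
  rintro _ ⟨x₀, hx₀, rfl⟩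
  set y := Φ x₀ with hy
  by_contra hyK
  have hK : IsCompact (closure Ω) := hΩb.isCompact_closure
  have hKc : IsClosed (Φ₀ '' closure Ω) := (hK.image_of_continuousOn hΦ₀c).isClosed
  obtain ⟨ρ, hρ, hball⟩ := Metric.mem_nhds_iff.1 (hKc.isOpen_compl.mem_nhds hyK)
  have hfar : ∀ x ∈ closure Ω, ρ ≤ dist (Φ₀ x) y := by
    intro x hx
    by_contra hc
    exact hball (Metric.mem_ball.2 (not_le.1 hc)) ⟨x, hx, rfl⟩
  obtain ⟨g, hg⟩ := ContinuousMap.exists_restrict_eq isClosed_closure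
    (⟨_, hΦ₀c.restrict⟩ : C(closure Ω, Fin n → ℝ))
  have hg' : ∀ x ∈ closure Ω, g x = Φ₀ x := fun x hx => by
    have := congrArg (fun h => h ⟨x, hx⟩) hg
    simpa using this
  obtain ⟨P, hP, hPg⟩ := approx_smooth g (half_pos hρ)
  have hfrc : ∀ x ∈ frontier Ω, x ∈ closure Ω := fun x hx => frontier_subset_closure hx
  obtain ⟨s, hs, -⟩ := local_structure hΩo hΩb hΦc hΦd y
    (fun x hx h => by
      have := hfar x (hfrc x hx)
      rw [← hbd x hx, h, dist_self] at this; linarith)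
    (fun x hx _ => (hdet x hx).ne')
  have hPy : ∀ x ∈ Ω, P x ≠ y := fun x hx h => by
    have h1 := hfar x (subset_closure hx)
    have h2 := hPg x
    rw [hg' x (subset_closure hx), h, dist_comm] at h2
    linarith
  have := degree_congr hΩo hΩb hΦc hΦd hP.continuous.continuousOn hP.contDiffOn y (ρ/2)
    (half_pos hρ) (fun x hx => by
      have := hfar x (hfrc x hx)
      rw [hbd x hx]; linarith)
    (fun x hx => by
      rw [hbd x hx, ← hg' x (hfrc x hx), dist_comm]; exact hPg x)
    (fun x hx _ => (hdet x hx).ne') (fun x hx h => absurd h (hPy x hx)) s hs ∅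
    (fun x => by
      simp only [Finset.notMem_empty, false_iff, not_and]
      exact hPy x)
  rw [Finset.sum_empty, Finset.sum_congr rfl (g := fun _ => (1:ℤ)) (fun x hx => by
    rw [sign_pos (hdet x ((hs x).1 hx).1)]; rfl)] at this
  simp only [Finset.sum_const, nsmul_eq_mul, mul_one, Nat.cast_eq_zero, Finset.card_eq_zero] at this
  have h := (hs x₀).2 ⟨hx₀, rfl⟩
  rw [this] at h
  simp at h

lemma main_step2 {n : ℕ} {Ω : Set (Fin n → ℝ)} (hΩo : IsOpen Ω) (hΩb : Bornology.IsBounded Ω)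
    {Φ Φ₀ : (Fin n → ℝ) → (Fin n → ℝ)}
    (hΦc : ContinuousOn Φ (closure Ω)) (hΦd : ContDiffOn ℝ 1 Φ Ω)
    (hdet : ∀ x ∈ Ω, 0 < (fderiv ℝ Φ x).det)
    (hΦ₀c : ContinuousOn Φ₀ (closure Ω)) (hΦ₀i : Set.InjOn Φ₀ (closure Ω))
    (hbd : ∀ x ∈ frontier Ω, Φ x = Φ₀ x) (z₀ : Fin n → ℝ) (hz₀ : z₀ ∈ Ω) :
    ∃! x, x ∈ Ω ∧ Φ x = Φ₀ z₀ := by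
  classical
  have hsub := main_step1 hΩo hΩb hΦc hΦd hdet hΦ₀c hbd
  have hK : IsCompact (closure Ω) := hΩb.isCompact_closure
  have hfrc : ∀ x ∈ frontier Ω, x ∈ closure Ω := fun x hx => frontier_subset_closure hx
  obtain ⟨k, ⟨s₀, hs₀, hk₀⟩, hk⟩ := count_locally_const hΩo hΩb hΦc hΦd (Φ₀ z₀)
    (fun x hx h => by
      rw [hbd x hx] at h
      have := hΦ₀i (hfrc x hx) (subset_closure hz₀) h
      rw [hΩo.frontier_eq] at hx
      exact hx.2 (this ▸ hz₀)) (fun x hx _ => (hdet x hx).ne')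
  have h1 : ∀ᶠ x in 𝓝[closure Ω] z₀, ∃ s : Finset (Fin n → ℝ),
      (∀ x', x' ∈ s ↔ x' ∈ Ω ∧ Φ x' = Φ₀ x) ∧ s.card = k :=
    (hΦ₀c z₀ (subset_closure hz₀)).eventually hk
  rw [eventually_nhdsWithin_iff, Metric.eventually_nhds_iff] at h1
  obtain ⟨η, hη, h1⟩ := h1
  obtain ⟨ρ, hρ, hball⟩ := Metric.mem_nhds_iff.1 (hΩo.mem_nhds hz₀)
  obtain ⟨ε, hε, hε'⟩ : ∃ ε > 0, 2 * ε ≤ η ∧ 3 * ε ≤ ρ :=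
    ⟨min (η/2) (ρ/3), by positivity, by
      have := min_le_left (η/2) (ρ/3); linarith, by
      have := min_le_right (η/2) (ρ/3); linarith⟩
  -- a continuous left inverse of `Φ₀`
  haveI : CompactSpace (closure Ω) := isCompact_iff_compactSpace.1 hK
  obtain ⟨g, hg⟩ := ContinuousMap.exists_extension' (e := (closure Ω).restrict Φ₀)
    (hΦ₀c.restrict.isClosedEmbedding (injOn_iff_injective.1 hΦ₀i))
    (⟨Subtype.val, continuous_subtype_val⟩ : C(closure Ω, Fin n → ℝ))
  have hg' : ∀ x ∈ closure Ω, g (Φ₀ x) = x := fun x hx => congrFun hg ⟨x, hx⟩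
  obtain ⟨G, hG, hGg⟩ := approx_smooth g hε
  obtain ⟨z₁, hz₁, hreg⟩ := exists_regular_value hG z₀ hε
  have hfiber : ∀ x ∈ Ω, G (Φ x) = z₁ → ∃ s : Finset (Fin n → ℝ),
      (∀ x', x' ∈ s ↔ x' ∈ Ω ∧ Φ x' = Φ x) ∧ s.card = k := by
    intro x hx hGx
    obtain ⟨w, hw, hwx⟩ := hsub ⟨x, hx, rfl⟩
    have h2 := hGg (Φ x)
    rw [hGx, ← hwx, hg' w hw] at h2
    have h3 : dist w z₀ < η := by
      have := dist_triangle w z₁ z₀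
      rw [dist_comm w z₁] at this
      linarith
    rw [← hwx]
    exact h1 h3 hw
  have hchain : ∀ x ∈ Ω, (fderiv ℝ (fun x => G (Φ x)) x).det =
      (fderiv ℝ G (Φ x)).det * (fderiv ℝ Φ x).det := by
    intro x hx
    have h1 := (hG.differentiable one_ne_zero (Φ x)).hasFDerivAt
    have h2 := ((hΦd.contDiffAt (hΩo.mem_nhds hx)).differentiableAt one_ne_zero).hasFDerivAt
    have h3 := (h1.comp x h2).fderiv
    change (fderiv ℝ (G ∘ Φ) x).det = _
    rw [h3]
    exact LinearMap.det_comp _ _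
  have hfc : ContinuousOn (fun x => G (Φ x)) (closure Ω) := hG.continuous.comp_continuousOn hΦc
  have hfd : ContDiffOn ℝ 1 (fun x => G (Φ x)) Ω := hG.comp_contDiffOn hΦd
  have hfar : ∀ x ∈ frontier Ω, 2 * ε ≤ dist x z₁ := by
    intro x hx
    rw [hΩo.frontier_eq] at hx
    have : ρ ≤ dist x z₀ := by
      by_contra hc
      exact hx.2 (hball (not_le.1 hc))
    have := dist_triangle x z₁ z₀
    linarith
  have hclose : ∀ x ∈ frontier Ω, dist x (G (Φ x)) < ε := by
    intro x hx
    have := hGg (Φ x)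
    rw [hbd x hx, hg' x (hfrc x hx)] at this
    rw [hbd x hx, dist_comm]; exact this
  have hreg' : ∀ x ∈ Ω, G (Φ x) = z₁ → (fderiv ℝ (fun x => G (Φ x)) x).det ≠ 0 := by
    intro x hx h
    rw [hchain x hx]
    exact mul_ne_zero (hreg _ h) (hdet x hx).ne'
  obtain ⟨s, hs, -⟩ := local_structure hΩo hΩb hfc hfd z₁ (fun x hx h => by
    have h1 := hfar x hx
    have h2 := hclose x hx
    rw [h] at h2; linarith) hreg'
  have hid : ∀ x : Fin n → ℝ, (fderiv ℝ (fun x => x) x : (Fin n → ℝ) →L[ℝ] (Fin n → ℝ)).det = 1 := by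
    intro x
    rw [fderiv_id']
    exact LinearMap.det_id
  have hz₁Ω : z₁ ∈ Ω := hball (by
    rw [Metric.mem_ball]; linarith)
  have key := degree_congr hΩo hΩb (f := fun x => x) continuousOn_id contDiffOn_id hfc hfd z₁ ε hε
    hfar hclose (fun x _ _ => by rw [hid]; exact one_ne_zero) hreg' {z₁}
    (fun x => by
      rw [Finset.mem_singleton]
      exact ⟨fun h => ⟨h ▸ hz₁Ω, h⟩, fun h => h.2⟩) s hs
  rw [Finset.sum_singleton, hid] at key
  have hdvd : (k : ℤ) ∣ 1 := by
    have h1 : ((SignType.sign (1:ℝ) : SignType) : ℤ) = 1 := by simp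
    rw [← h1, key, ← Finset.sum_fiberwise_of_maps_to (s := s) (t := s.image Φ) (g := Φ)
      (fun x hx => Finset.mem_image_of_mem _ hx)]
    refine Finset.dvd_sum fun y hy => ?_
    obtain ⟨x, hx, rfl⟩ := Finset.mem_image.1 hy
    obtain ⟨hxΩ, hGx⟩ := (hs x).1 hx
    obtain ⟨t, ht, htk⟩ := hfiber x hxΩ hGx
    have hst : s.filter (fun x' => Φ x' = Φ x) = t := by
      ext x'
      rw [Finset.mem_filter, hs, ht]
      constructor
      · rintro ⟨⟨h, -⟩, h'⟩; exact ⟨h, h'⟩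
      · rintro ⟨h, h'⟩; exact ⟨⟨h, by rw [h']; exact hGx⟩, h'⟩
    rw [hst, Finset.sum_congr rfl
      (g := fun _ => ((SignType.sign (fderiv ℝ G (Φ x)).det : SignType) : ℤ)) (fun x' hx' => by
        obtain ⟨h, h'⟩ := (ht x').1 hx'
        rw [hchain x' h, sign_mul, sign_pos (hdet x' h), mul_one, h'])]
    rw [Finset.sum_const, htk, nsmul_eq_mul]
    exact dvd_mul_right _ _
  have hk1 : k = 1 := by
    have : k ∣ 1 := by exact_mod_cast hdvd
    exact Nat.dvd_one.1 this
  rw [hk1, Finset.card_eq_one] at hk₀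
  obtain ⟨a, rfl⟩ := hk₀
  refine ⟨a, (hs₀ a).1 (Finset.mem_singleton_self a), fun b hb => ?_⟩
  exact Finset.mem_singleton.1 ((hs₀ b).2 hb)

lemma image_nhds {n : ℕ} {Ω : Set (Fin n → ℝ)} (hΩo : IsOpen Ω)
    {Φ : (Fin n → ℝ) → (Fin n → ℝ)} (hΦd : ContDiffOn ℝ 1 Φ Ω)
    (hdet : ∀ x ∈ Ω, 0 < (fderiv ℝ Φ x).det) {x : Fin n → ℝ} (hx : x ∈ Ω)
    {U : Set (Fin n → ℝ)} (hU : U ∈ 𝓝 x) : Φ '' U ∈ 𝓝 (Φ x) := by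
  have h1 := (hΦd.contDiffAt (hΩo.mem_nhds hx)).hasStrictFDerivAt one_ne_zero
  have h2 : HasStrictFDerivAt Φ (((fderiv ℝ Φ x).toContinuousLinearEquivOfDetNeZero
    (hdet x hx).ne' : (Fin n → ℝ) ≃L[ℝ] (Fin n → ℝ)) : (Fin n → ℝ) →L[ℝ] (Fin n → ℝ)) x := by
    simpa using h1
  rw [← h2.map_nhds_eq_of_equiv]
  exact image_mem_map hU

/-- Ciarlet's global injectivity criterion: if Φ is continuous on cl(Ω), C¹ on Ω with
positive Jacobian determinant, and agrees on ∂Ω with an injective continuous map Φ₀,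
then Φ is injective on cl(Ω) with Φ(cl Ω) = Φ₀(cl Ω) and Φ(Ω) = Φ₀(Ω). -/
theorem stmt_5 (n : ℕ) (Ω : Set (Fin n → ℝ)) (hΩo : IsOpen Ω) (hΩb : Bornology.IsBounded Ω)
    (Φ Φ₀ : (Fin n → ℝ) → (Fin n → ℝ))
    (hΦc : ContinuousOn Φ (closure Ω)) (hΦd : ContDiffOn ℝ 1 Φ Ω)
    (hdet : ∀ x ∈ Ω, 0 < LinearMap.det ((fderiv ℝ Φ x).toLinearMap))
    (hΦ₀c : ContinuousOn Φ₀ (closure Ω)) (hΦ₀i : Set.InjOn Φ₀ (closure Ω))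
    (hbd : ∀ x ∈ frontier Ω, Φ x = Φ₀ x) :
    Set.InjOn Φ (closure Ω) ∧ Φ '' closure Ω = Φ₀ '' closure Ω ∧ Φ '' Ω = Φ₀ '' Ω := by
  have hdet' : ∀ x ∈ Ω, 0 < (fderiv ℝ Φ x).det := hdet
  have hsub := main_step1 hΩo hΩb hΦc hΦd hdet' hΦ₀c hbd
  have huniq := main_step2 hΩo hΩb hΦc hΦd hdet' hΦ₀c hΦ₀i hbd
  have hfr : ∀ x ∈ closure Ω, x ∉ Ω → x ∈ frontier Ω := fun x hx h => by
    rw [hΩo.frontier_eq]; exact ⟨hx, h⟩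
  have hfrc : ∀ x ∈ frontier Ω, x ∈ closure Ω := fun x hx => frontier_subset_closure hx
  have hfrn : ∀ x ∈ frontier Ω, x ∉ Ω := fun x hx => by
    rw [hΩo.frontier_eq] at hx; exact hx.2
  -- interior points are not mapped to boundary values
  have hdisj : ∀ x ∈ Ω, ∀ b ∈ frontier Ω, Φ x ≠ Φ b := by
    intro x hx b hb hxb
    have hne : x ≠ b := fun h => hfrn b hb (h ▸ hx)
    obtain ⟨U, W, hUo, hWo, hxU, hbW, hUW⟩ := t2_separation hne
    have hUΩ : U ∩ Ω ∈ 𝓝 x := (hUo.inter hΩo).mem_nhds ⟨hxU, hx⟩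
    have h1 : Φ '' (U ∩ Ω) ∈ 𝓝 (Φ b) := hxb ▸ image_nhds hΩo hΦd hdet' hx hUΩ
    have h2 : ∀ᶠ w in 𝓝[closure Ω] b, Φ w ∈ Φ '' (U ∩ Ω) :=
      (hΦc b (hfrc b hb)).eventually h1
    have h3 : ∀ᶠ w in 𝓝 b, w ∈ W ∧ (w ∈ closure Ω → Φ w ∈ Φ '' (U ∩ Ω)) :=
      Filter.Eventually.and (hWo.mem_nhds hbW) (eventually_nhdsWithin_iff.1 h2)
    obtain ⟨W', hW', hW'o, hbW'⟩ := eventually_nhds_iff.1 h3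
    obtain ⟨w₀, hw₀W, hw₀⟩ := mem_closure_iff.1 (hfrc b hb) W' hW'o hbW'
    have h4 : Φ '' (W' ∩ Ω) ∈ 𝓝 (Φ w₀) :=
      image_nhds hΩo hΦd hdet' hw₀ ((hW'o.inter hΩo).mem_nhds ⟨hw₀W, hw₀⟩)
    obtain ⟨c, hc, hcw⟩ := hsub ⟨w₀, hw₀, rfl⟩
    have h5 : ∀ᶠ v in 𝓝[closure Ω] c, Φ₀ v ∈ Φ '' (W' ∩ Ω) :=
      (hΦ₀c c hc).eventually (by rw [hcw]; exact h4)
    obtain ⟨W₂, hW₂, hW₂o, hcW₂⟩ := eventually_nhds_iff.1 (eventually_nhdsWithin_iff.1 h5)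
    obtain ⟨v, hvW, hv⟩ := mem_closure_iff.1 hc W₂ hW₂o hcW₂
    obtain ⟨p, ⟨hpW, hpΩ⟩, hp⟩ := hW₂ v hvW (subset_closure hv)
    obtain ⟨q, ⟨hqU, hqΩ⟩, hq⟩ := (hW' p hpW).2 (subset_closure hpΩ)
    have hpq : p = q := (huniq v hv).unique ⟨hpΩ, hp⟩ ⟨hqΩ, hq.trans hp⟩
    exact Set.disjoint_left.1 hUW hqU (hpq ▸ (hW' p hpW).1)
  have himg : Φ '' Ω = Φ₀ '' Ω := by
    apply Subset.antisymm
    · rintro _ ⟨x, hx, rfl⟩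
      obtain ⟨c, hc, hcx⟩ := hsub ⟨x, hx, rfl⟩
      refine ⟨c, ?_, hcx⟩
      by_contra hcΩ
      exact hdisj x hx c (hfr c hc hcΩ) (by rw [hbd c (hfr c hc hcΩ), hcx])
    · rintro _ ⟨x, hx, rfl⟩
      obtain ⟨a, ha, -⟩ := huniq x hx
      exact ⟨a, ha⟩
  refine ⟨?_, ?_, himg⟩
  · intro x hx y hy hxy
    by_cases hxΩ : x ∈ Ω
    · by_cases hyΩ : y ∈ Ω
      · obtain ⟨c, hc, hcx⟩ : Φ x ∈ Φ₀ '' Ω := himg ▸ ⟨x, hxΩ, rfl⟩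
        exact (huniq c hc).unique ⟨hxΩ, hcx.symm⟩ ⟨hyΩ, hxy ▸ hcx.symm⟩
      · exact absurd hxy (hdisj x hxΩ y (hfr y hy hyΩ))
    · by_cases hyΩ : y ∈ Ω
      · exact absurd hxy.symm (hdisj y hyΩ x (hfr x hx hxΩ))
      · rw [hbd x (hfr x hx hxΩ), hbd y (hfr y hy hyΩ)] at hxy
        exact hΦ₀i hx hy hxy
  · have hcl : closure Ω = Ω ∪ frontier Ω := by
      ext x
      exact ⟨fun h => (em (x ∈ Ω)).imp id (hfr x h), fun h => h.elim (fun h => subset_closure h) (hfrc x)⟩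
    rw [hcl, image_union, image_union, himg]
    congr 1
    exact image_congr hbd
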